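/- Let p ≥ 5 be odd and suppose (m·u² + n·u + m)·(u^{(p−1)/2} − 1)² = ± u^l·(u − 1)² in ℤ[u,u⁻¹]/(u^{p−1} + ⋯ + u + 1) for integers m, n, l. If p = 5 then (m,n) = ±(−1,1); if p ≥ 7 then there is no integer solution (m,n). -/

import Mathlib

/-- The ring `ℤ[u, u⁻¹]/(u^{p-1} + ⋯ + u + 1)`; since `u^p = 1` here, `u` is a unit. -/
noncomputable abbrev cyclicQuot (p : ℕ) :=
  Polynomial ℤ ⧸ Ideal.span {∑ i ∈ Finset.range p, (Polynomial.X : Polynomial ℤ) ^ i}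

/-- The class of `u`. -/
noncomputable abbrev uu (p : ℕ) : cyclicQuot p := Ideal.Quotient.mk _ Polynomial.X

open Polynomial in
/-- An integer polynomial of degree less than `p` that vanishes at `1` and is divisible by
`1 + X + ⋯ + X ^ (p - 1)` is zero. -/
theorem eq_zero_of_geom_sum_dvd {p : ℕ} (hp : 0 < p) {P : ℤ[X]} (hdeg : P.natDegree < p)
    (hone : P.eval 1 = 0) (hdvd : (∑ i ∈ Finset.range p, (X : ℤ[X]) ^ i) ∣ P) : P = 0 := by
  obtain ⟨c, rfl⟩ := hdvd
  have hc : c.eval 1 = 0 := by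
    have h : (p : ℤ) * c.eval 1 = 0 := by simpa [eval_finsetSum] using hone
    exact (mul_eq_zero.mp h).resolve_left (by exact_mod_cast hp.ne')
  obtain ⟨d, rfl⟩ := dvd_iff_isRoot.mpr hc
  refine eq_zero_of_dvd_of_natDegree_lt (p := X ^ p - C 1) ⟨d, ?_⟩ (by rwa [natDegree_X_pow_sub_C])
  rw [← mul_assoc, C_1, geom_sum_mul]

theorem uu_pow_self (p : ℕ) : uu p ^ p = 1 := by
  have h : (∑ i ∈ Finset.range p, uu p ^ i) = 0 := by
    simpa using (Ideal.Quotient.eq_zero_iff_mem (I := Ideal.span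
      {∑ i ∈ Finset.range p, (Polynomial.X : Polynomial ℤ) ^ i})).mpr
      (Ideal.mem_span_singleton_self _)
  rw [← sub_eq_zero, ← geom_sum_mul, h, zero_mul]

theorem exists_lt_uu_pow_succ {p r : ℕ} (hr : r < p) :
    ∃ s < p, (s = r + 1 ∨ r + 1 = p ∧ s = 0) ∧ uu p ^ (r + 1) = uu p ^ s := by
  rcases Nat.lt_or_ge (r + 1) p with h | h
  · exact ⟨r + 1, h, Or.inl rfl, rfl⟩
  · have h' : r + 1 = p := by omega
    exact ⟨0, by omega, Or.inr ⟨h', rfl⟩, by rw [h', uu_pow_self, pow_zero]⟩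

open Polynomial in
/-- Comparison of coefficients, with all exponents reduced modulo `2 * h + 1`. -/
theorem coeff_identity {h : ℕ} (hh : 2 ≤ h) (m n ε : ℤ) {r s t : ℕ} (hr : r < 2 * h + 1)
    (hs : s < 2 * h + 1) (ht : t < 2 * h + 1)
    (heq : ((m : cyclicQuot (2 * h + 1)) * uu (2 * h + 1) ^ 2 + n * uu (2 * h + 1) + m) *
        (uu (2 * h + 1) ^ h - 1) ^ 2
      = ε * (uu (2 * h + 1) ^ r - 2 * uu (2 * h + 1) ^ s + uu (2 * h + 1) ^ t)) (j : ℕ) :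
    m * ((if j = 2 * h then 1 else 0) + (if j = 2 then 1 else 0) - 2 * (if j = h then 1 else 0)
        - 2 * (if j = h + 2 then 1 else 0))
      + (m + n) * ((if j = 0 then 1 else 0) + (if j = 1 then 1 else 0))
      - 2 * n * (if j = h + 1 then 1 else 0)
      = ε * ((if j = r then 1 else 0) - 2 * (if j = s then 1 else 0)
        + (if j = t then 1 else 0)) := by
  let P : ℤ[X] := C m * (X ^ (2 * h) + X ^ 2 - C 2 * X ^ h - C 2 * X ^ (h + 2))
    + C (m + n) * (X ^ 0 + X ^ 1) - C (2 * n) * X ^ (h + 1)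
    - C ε * (X ^ r - C 2 * X ^ s + X ^ t)
  have hcoeff (j : ℕ) : P.coeff j =
      m * ((if j = 2 * h then 1 else 0) + (if j = 2 then 1 else 0) - 2 * (if j = h then 1 else 0)
        - 2 * (if j = h + 2 then 1 else 0))
      + (m + n) * ((if j = 0 then 1 else 0) + (if j = 1 then 1 else 0))
      - 2 * n * (if j = h + 1 then 1 else 0)
      - ε * ((if j = r then 1 else 0) - 2 * (if j = s then 1 else 0)
        + (if j = t then 1 else 0)) := by
    simp only [P, coeff_add, coeff_sub, coeff_C_mul, coeff_X_pow]
  have hdeg : P.natDegree < 2 * h + 1 := by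
    refine Nat.lt_succ_of_le (natDegree_le_iff_coeff_eq_zero.mpr fun k hk => ?_)
    rw [hcoeff, if_neg (by omega), if_neg (by omega), if_neg (by omega), if_neg (by omega),
      if_neg (by omega), if_neg (by omega), if_neg (by omega), if_neg (by omega),
      if_neg (by omega), if_neg (by omega)]
    ring
  have hone : P.eval 1 = 0 := by
    simp only [P, eval_add, eval_sub, eval_mul, eval_C, eval_pow, eval_X, one_pow]
    ring
  have hdvd : (∑ i ∈ Finset.range (2 * h + 1), (X : ℤ[X]) ^ i) ∣ P := by
    rw [← Ideal.mem_span_singleton, ← Ideal.Quotient.eq_zero_iff_mem]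
    have hC (a : ℤ) : Ideal.Quotient.mk (Ideal.span
        {∑ i ∈ Finset.range (2 * h + 1), (X : ℤ[X]) ^ i}) (C a) = (a : cyclicQuot (2 * h + 1)) := by
      simp
    have hu := uu_pow_self (2 * h + 1)
    simp only [P, map_add, map_sub, map_mul, map_pow, hC]
    push_cast
    linear_combination heq - ((m : cyclicQuot (2 * h + 1)) * uu (2 * h + 1) + n) * hu
  have hP := hcoeff j
  rw [eq_zero_of_geom_sum_dvd (by omega) hdeg hone hdvd, coeff_zero] at hP
  linarith

/-- Case (ii)(b) (`c = 1`) in the proof of Lemma 4.2(1) of Kadokami: for odd `p ≥ 5`,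
if `(mu² + nu + m)(u^{(p−1)/2} − 1)² = ±u^l(u − 1)²` in `ℤ[u,u⁻¹]/(u^{p-1}+⋯+1)`,
then for `p = 5` necessarily `(m, n) = ±(−1, 1)`, and for `p ≥ 7` there is no
integer solution `(m, n)`. -/
theorem case_c_eq_one (p : ℕ) (hp : 5 ≤ p) (hodd : Odd p) (m n : ℤ) (l : ℕ)
    (ε : ℤ) (hε : ε = 1 ∨ ε = -1)
    (heq : ((m : cyclicQuot p) * uu p ^ 2 + (n : cyclicQuot p) * uu p + (m : cyclicQuot p)) *
        (uu p ^ ((p - 1) / 2) - 1) ^ 2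
      = (ε : cyclicQuot p) * uu p ^ l * (uu p - 1) ^ 2) :
    (p = 5 → (m = -1 ∧ n = 1) ∨ (m = 1 ∧ n = -1)) ∧ (7 ≤ p → False) := by
  obtain ⟨h, rfl⟩ := hodd
  have hpow : uu (2 * h + 1) ^ l = uu (2 * h + 1) ^ (l % (2 * h + 1)) :=
    pow_eq_pow_mod l (uu_pow_self _)
  have hr : l % (2 * h + 1) < 2 * h + 1 := Nat.mod_lt _ (by omega)
  generalize l % (2 * h + 1) = r at hpow hr
  obtain ⟨s, hs, hrs, hus⟩ := exists_lt_uu_pow_succ hr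
  obtain ⟨t, ht, hst, hut⟩ := exists_lt_uu_pow_succ hs
  have hhalf : (2 * h + 1 - 1) / 2 = h := by omega
  rw [hhalf, hpow] at heq
  have key := coeff_identity (by omega) m n ε hr hs ht (heq.trans (by
    rw [← hut, pow_succ _ s, ← hus]
    ring))
  have hs' := key s
  refine ⟨fun h5 => ?_, fun h7 => ?_⟩
  · obtain rfl : h = 2 := by omega
    have h0 := key 0
    have h1 := key 1
    have h2 := key 2
    have h3 := key 3
    have h4 := key 4
    clear heq key hs' hpow hus hut
    norm_num at h0 h1 h2 h3 h4
    rcases hrs with rfl | ⟨hrs, rfl⟩ <;> rcases hst with rfl | ⟨hst, rfl⟩ <;>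
      interval_cases r <;> first | omega | (rcases hε with rfl | rfl <;>
        norm_num at h0 h1 h2 h3 h4 <;> omega)
  · have hm : m = 0 := by
      have h1 := key h
      have h2 := key (h + 2)
      simp (disch := omega) only [if_neg, if_true] at h1 h2
      rcases hε with rfl | rfl <;> split_ifs at h1 h2 <;> omega
    have hn : n = 0 := by
      subst hm
      have h1 := key (h + 1)
      have h2 := key 0
      simp (disch := omega) only [if_neg, if_true] at h1 h2
      rcases hε with rfl | rfl <;> split_ifs at h1 h2 <;> omega
    subst hm hn
    simp (disch := omega) only [if_neg, if_true, add_zero, mul_zero, zero_mul, sub_zero] at hs'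
    rcases hε with rfl | rfl <;> omega
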